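/- For any compact set K ⊂ ℝ, lim_{t→∞} sup_{u ∈ K} s²(t + u/s(t))/s²(t) = 1. -/

import Mathlib

open Real Filter Topology MeasureTheory Set

noncomputable section

/-- A representation of a function `l` in class `R₀`:
`l x = exp (∫_1^x ε u / u du)` for `x ≥ 1`, where `ε` is twice differentiable
(with first and second derivatives `ε'`, `ε''`) and `ε x → 0` as `x → ∞`. -/
def IsR0Rep (l ε ε' ε'' : ℝ → ℝ) : Prop :=
  (∀ x, HasDerivAt ε (ε' x) x) ∧ (∀ x, HasDerivAt ε' (ε'' x) x) ∧
    Tendsto ε atTop (𝓝 0) ∧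
    ∀ x ≥ (1 : ℝ), l x = Real.exp (∫ u in (1:ℝ)..x, ε u / u)

/-- The generalized inverse `ψ u = inf {x | h x ≥ u}` of `h`. -/
def geninv (h : ℝ → ℝ) (u : ℝ) : ℝ := sInf {x : ℝ | u ≤ h x}

/-- Class `R_β` (`β > 0`): `h x = x ^ β * l x` for large `x`, with `l ∈ R₀` whose
representing `ε` satisfies `limsup x * |ε' x| < ∞` and `limsup x ^ 2 * |ε'' x| < ∞`. -/
def MemRbeta (h : ℝ → ℝ) (β : ℝ) : Prop :=
  0 < β ∧ ∃ l ε ε' ε'' : ℝ → ℝ, IsR0Rep l ε ε' ε'' ∧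
    (∀ᶠ x in atTop, h x = x ^ β * l x) ∧
    (∃ C : ℝ, ∀ᶠ x in atTop, x * |ε' x| ≤ C) ∧
    (∃ C : ℝ, ∀ᶠ x in atTop, x ^ (2 : ℕ) * |ε'' x| ≤ C)

/-- Class `R_∞`: `h` is increasing and strictly monotone and its generalized inverse
`ψ` satisfies `ψ x = exp (∫_1^x ε u / u du)` with `ψ x → ∞`, `x ε' x / ε x → 0`,
`x ^ 2 ε'' x / ε x → 0` and `liminf x ^ η * ε x > 0` for some `η ∈ (0, 1/4)`. -/
def MemRinfty (h : ℝ → ℝ) : Prop :=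
  StrictMonoOn h (Set.Ici 0) ∧
  ∃ ε ε' ε'' : ℝ → ℝ,
    (∀ x, HasDerivAt ε (ε' x) x) ∧ (∀ x, HasDerivAt ε' (ε'' x) x) ∧
    (∀ x ≥ (1 : ℝ), geninv h x = Real.exp (∫ u in (1:ℝ)..x, ε u / u)) ∧
    Tendsto (geninv h) atTop atTop ∧
    Tendsto (fun x => x * ε' x / ε x) atTop (𝓝 0) ∧
    Tendsto (fun x => x ^ (2 : ℕ) * ε'' x / ε x) atTop (𝓝 0) ∧
    ∃ η : ℝ, η ∈ Set.Ioo (0 : ℝ) (1/4) ∧ ∃ c > (0 : ℝ), ∀ᶠ x in atTop, c ≤ x ^ η * ε x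

/-- The class `𝔯 = R_β ∪ R_∞`. -/
def MemFrakR (h : ℝ → ℝ) : Prop := (∃ β : ℝ, MemRbeta h β) ∨ MemRinfty h

/-- The moment generating function `Φ t = ∫_0^∞ e^{t x} p x dx`. -/
def mgfFun (p : ℝ → ℝ) (t : ℝ) : ℝ := ∫ x in Set.Ici (0:ℝ), Real.exp (t * x) * p x

/-- `m = (log Φ)'`, the mean of the tilted density. -/
def mFun (p : ℝ → ℝ) : ℝ → ℝ := deriv fun t => Real.log (mgfFun p t)

/-- `s² = m'`, the variance of the tilted density. -/
def s2Fun (p : ℝ → ℝ) : ℝ → ℝ := deriv (mFun p)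

/-- `μ₃ = (log Φ)'''`, the third centered moment of the tilted density. -/
def mu3Fun (p : ℝ → ℝ) : ℝ → ℝ := deriv (s2Fun p)


/-- The second logarithmic derivative of the Laplace transform is the variance of the tilted
density. -/
lemma s2Fun_eq_of_integrable {p : ℝ → ℝ} (hp0 : ∀ x ≥ (0:ℝ), 0 ≤ p x)
    (hint : IntegrableOn p (Ici 0))
    (hPhi : ∀ t > (0:ℝ), IntegrableOn (fun x => Real.exp (t * x) * p x) (Set.Ici 0))
    {t : ℝ} (ht : 0 < t) :
    (∀ n : ℕ, IntegrableOn (fun x => x ^ n * (Real.exp (t * x) * p x)) (Ici 0)) ∧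
    s2Fun p t = (∫ x in Ici (0:ℝ), x ^ 2 * (Real.exp (t * x) * p x)) / mgfFun p t -
      ((∫ x in Ici (0:ℝ), x * (Real.exp (t * x) * p x)) / mgfFun p t) ^ 2 := by
  set ν : Measure ℝ := volume.restrict (Ici (0:ℝ))
  set μ : Measure ℝ := ν.withDensity (fun x => ENNReal.ofReal (p x))
  have hm : AEMeasurable (fun x => ENNReal.ofReal (p x)) ν :=
    (Integrable.aemeasurable hint).ennreal_ofReal
  have htop : ∀ᵐ x ∂ν, ENNReal.ofReal (p x) < ⊤ := by simp
  have hnn : ∀ᵐ x ∂ν, (ENNReal.ofReal (p x)).toReal = p x := by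
    filter_upwards [ae_restrict_mem measurableSet_Ici] with x hx
    exact ENNReal.toReal_ofReal (hp0 x hx)
  have hI : ∀ f : ℝ → ℝ, ∫ x, f x ∂μ = ∫ x in Ici (0:ℝ), f x * p x := by
    intro f
    rw [integral_withDensity_eq_integral_toReal_smul₀ hm htop]
    refine integral_congr_ae ?_
    filter_upwards [hnn] with x hx
    rw [hx, smul_eq_mul, mul_comm]
  have hint' : ∀ f : ℝ → ℝ, Integrable f μ ↔ IntegrableOn (fun x => f x * p x) (Ici 0) := by
    intro f
    rw [integrable_withDensity_iff_integrable_smul₀' hm htop, IntegrableOn]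
    refine integrable_congr ?_
    filter_upwards [hnn] with x hx
    rw [hx, smul_eq_mul, mul_comm]
  have hsub : Ioi (0:ℝ) ⊆ ProbabilityTheory.integrableExpSet id μ := fun s hs =>
    (hint' (fun x => Real.exp (s * x))).2 (hPhi s hs)
  have hmem : t ∈ interior (ProbabilityTheory.integrableExpSet id μ) :=
    interior_maximal hsub isOpen_Ioi ht
  have hmgf : ∀ s, ProbabilityTheory.mgf id μ s = mgfFun p s := fun s =>
    hI (fun x => Real.exp (s * x))
  have hs2 : s2Fun p t = iteratedDeriv 2 (ProbabilityTheory.cgf id μ) t := by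
    rw [iteratedDeriv_succ, iteratedDeriv_one]
    have : (fun t => Real.log (mgfFun p t)) = ProbabilityTheory.cgf id μ := by
      funext s
      simp [ProbabilityTheory.cgf, hmgf]
    simp only [s2Fun, mFun, this]
  refine ⟨fun n => ?_, ?_⟩
  · have := (hint' _).1 (ProbabilityTheory.integrable_pow_mul_exp_of_mem_interior_integrableExpSet
      hmem n)
    simpa [mul_assoc] using this
  · rw [hs2, ProbabilityTheory.iteratedDeriv_two_cgf hmem, ProbabilityTheory.deriv_cgf hmem,
      hmgf, hI, hI]
    simp only [id, mul_assoc, ν]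

/-- Recentred and rescaled powers are integrable against the tilted density. -/
lemma integrableOn_rescaled_pow {p : ℝ → ℝ} (hp0 : ∀ x ≥ (0:ℝ), 0 ≤ p x)
    (hint : IntegrableOn p (Ici 0))
    (hPhi : ∀ t > (0:ℝ), IntegrableOn (fun x => Real.exp (t * x) * p x) (Set.Ici 0))
    {t : ℝ} (ht : 0 < t) (a σ : ℝ) (n : ℕ) :
    IntegrableOn (fun x => ((x - a) / σ) ^ n * (Real.exp (t * x) * p x)) (Ici 0) := by
  have hi := (s2Fun_eq_of_integrable hp0 hint hPhi ht).1
  have : (fun x => ((x - a) / σ) ^ n * (Real.exp (t * x) * p x)) = fun x =>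
      ∑ m ∈ Finset.range (n + 1), ((-a) ^ (n - m) * (n.choose m) / σ ^ n) *
        (x ^ m * (Real.exp (t * x) * p x)) := by
    funext x
    rw [div_pow, sub_eq_add_neg, add_pow, Finset.sum_div, Finset.sum_mul]
    refine Finset.sum_congr rfl fun m _ => ?_
    ring
  rw [this]
  exact integrable_finsetSum _ fun m _ => (hi m).const_mul _

/-- The tilted variance expressed through recentred and rescaled moments. -/
lemma s2Fun_eq_rescaled {p : ℝ → ℝ} (hp0 : ∀ x ≥ (0:ℝ), 0 ≤ p x)
    (hint : IntegrableOn p (Ici 0))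
    (hPhi : ∀ t > (0:ℝ), IntegrableOn (fun x => Real.exp (t * x) * p x) (Set.Ici 0))
    {t : ℝ} (ht : 0 < t) (a : ℝ) {σ : ℝ} (hσ : 0 < σ)
    {M : ℕ → ℝ}
    (hM : ∀ n, M n = ∫ x in Ici (0:ℝ), ((x - a) / σ) ^ n * (Real.exp (t * x) * p x))
    (hM0 : M 0 ≠ 0) :
    s2Fun p t = σ ^ 2 * (M 2 / M 0 - (M 1 / M 0) ^ 2) := by
  obtain ⟨hi, hs⟩ := s2Fun_eq_of_integrable hp0 hint hPhi ht
  have h0 := hPhi t ht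
  have h1 := hi 1
  have h2 := hi 2
  simp only [pow_one] at h1
  have e0 : mgfFun p t = M 0 := by simp [hM, mgfFun]
  have e1 : ∫ x in Ici (0:ℝ), x * (Real.exp (t * x) * p x) = σ * M 1 + a * M 0 := by
    rw [hM, hM, ← integral_const_mul, ← integral_const_mul, ← integral_add]
    · refine integral_congr_ae (Eventually.of_forall fun x => ?_)
      simp only
      field_simp
      ring
    · refine Integrable.const_mul ?_ _
      refine ((h1.sub (h0.const_mul a)).const_mul σ⁻¹).congr (Eventually.of_forall fun x => ?_)
      simp only [Pi.sub_apply, pow_one]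
      field_simp
    · simpa using h0.const_mul a
  have e2 : ∫ x in Ici (0:ℝ), x ^ 2 * (Real.exp (t * x) * p x) =
      σ ^ 2 * M 2 + (2 * a * σ) * M 1 + a ^ 2 * M 0 := by
    have i1 := integrableOn_rescaled_pow hp0 hint hPhi ht a σ 1
    have i2 := integrableOn_rescaled_pow hp0 hint hPhi ht a σ 2
    rw [hM, hM, hM, ← integral_const_mul, ← integral_const_mul, ← integral_const_mul,
      ← integral_add (i2.const_mul _) (i1.const_mul _), ← integral_add]
    · refine integral_congr_ae (Eventually.of_forall fun x => ?_)
      simp only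
      field_simp
      ring
    · exact (i2.const_mul _).add (i1.const_mul _)
    · simpa using h0.const_mul (a ^ 2)
  rw [hs, e0, e1, e2]
  field_simp
  ring

/-- `ψ` is, near infinity, a differentiable right inverse of the eventually monotone function `h`,
and its derivative `D` is such that `1 / √D` is self-neglecting. -/
structure SelfNeglectingInverse (h ψ D : ℝ → ℝ) : Prop where
  tendsto : Tendsto ψ atTop atTop
  right_inv : ∀ᶠ t in atTop, h (ψ t) = t
  hasDerivAt : ∀ᶠ t in atTop, HasDerivAt ψ (D t) t
  pos : ∀ᶠ t in atTop, 0 < D t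
  monotoneOn : ∀ᶠ X in atTop, MonotoneOn h (Ici X)
  scale : Tendsto (fun t => t * √(D t)) atTop atTop
  neglect : ∀ A : ℝ, ∀ ε > (0:ℝ), ∀ᶠ t in atTop, ∀ u, |u| ≤ A →
    |D (t + u / √(D t)) / D t - 1| < ε

namespace SelfNeglectingInverse

variable {h ψ D : ℝ → ℝ}

/-- If `t * √(D t) → ∞`, shifts by a bounded multiple of `1 / √(D t)` are negligible against `t`. -/
lemma eventually_half_le (hs : Tendsto (fun t => t * √(D t)) atTop atTop) (A : ℝ) :
    ∀ᶠ t in atTop, ∀ u, |u| ≤ A → |u / √(D t)| ≤ t / 2 := by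
  filter_upwards [hs.eventually_ge_atTop (2 * A), hs.eventually_gt_atTop 0,
    eventually_gt_atTop 0] with t h1 h2 h3 u hu
  have hσ : 0 < √(D t) := by
    by_contra hn
    nlinarith [Real.sqrt_nonneg (D t)]
  rw [abs_div, abs_of_pos hσ, div_le_iff₀ hσ]
  linarith

lemma eventually_shift (hs : Tendsto (fun t => t * √(D t)) atTop atTop)
    {P : ℝ → Prop} (hP : ∀ᶠ t in atTop, P t) (A : ℝ) :
    ∀ᶠ t in atTop, ∀ u, |u| ≤ A → P (t + u / √(D t)) := by
  obtain ⟨T, hT⟩ := eventually_atTop.1 hP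
  filter_upwards [eventually_half_le hs A, eventually_ge_atTop (2 * T)] with t h1 h2 u hu
  refine hT _ ?_
  have := abs_le.1 (h1 u hu)
  linarith

lemma tendsto_inverse_shift (H : SelfNeglectingInverse h ψ D) (v : ℝ) :
    Tendsto (fun t => (ψ (t + v / √(D t)) - ψ t) / √(D t)) atTop (𝓝 v) := by
  rw [Metric.tendsto_atTop']
  intro ε hε
  have hε' : 0 < ε / (|v| + 1) := by positivity
  refine (eventually_atTop.1 ?_).imp fun N hN n hn => hN n hn.le
  filter_upwards [H.neglect |v| _ hε', H.pos, eventually_shift H.scale H.hasDerivAt |v|]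
    with t h1 h2 h3
  set σ := √(D t)
  have hσ : 0 < σ := Real.sqrt_pos.2 h2
  have hσ2 : σ ^ 2 = D t := Real.sq_sqrt h2.le
  have key : ‖(ψ (t + v / σ) - D t * (v / σ)) - (ψ (t + 0 / σ) - D t * (0 / σ))‖ ≤
      (ε / (|v| + 1) * σ) * ‖v - 0‖ := by
    refine (convex_Icc (-|v|) |v|).norm_image_sub_le_of_norm_hasDerivWithin_le
      (f := fun u => ψ (t + u / σ) - D t * (u / σ))
      (f' := fun u => D (t + u / σ) * (1 / σ) - D t * (1 / σ)) ?_ ?_ ?_ ?_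
    · intro u hu
      have hd : HasDerivAt (fun u : ℝ => u / σ) (1 / σ) u := (hasDerivAt_id u).div_const σ
      have := HasDerivAt.comp u (h3 u (abs_le.2 hu)) (hd.const_add t)
      exact (this.sub (hd.const_mul (D t))).hasDerivWithinAt
    · intro u hu
      have h4 := h1 u (abs_le.2 hu)
      have : D (t + u / σ) * (1 / σ) - D t * (1 / σ) = (D (t + u / σ) / D t - 1) * σ := by
        rw [← hσ2]
        field_simp
      rw [this, norm_mul, Real.norm_eq_abs, Real.norm_eq_abs, abs_of_pos hσ]
      exact mul_le_mul_of_nonneg_right h4.le hσ.le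
    · simp
    · exact ⟨neg_abs_le v, le_abs_self v⟩
  rw [Real.dist_eq]
  have e : (ψ (t + v / σ) - ψ t) / σ - v =
      ((ψ (t + v / σ) - D t * (v / σ)) - (ψ (t + 0 / σ) - D t * (0 / σ))) / σ := by
    rw [← hσ2]
    simp only [zero_div, add_zero, mul_zero, sub_zero]
    field_simp
    ring
  rw [e, abs_div, abs_of_pos hσ, div_lt_iff₀ hσ]
  simp only [Real.norm_eq_abs, sub_zero] at key
  refine key.trans_lt ?_
  have : ε / (|v| + 1) * |v| < ε := by
    rw [div_mul_eq_mul_div, div_lt_iff₀ (by positivity)]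
    nlinarith [abs_nonneg v]
  nlinarith

lemma tendsto_point_atTop (H : SelfNeglectingInverse h ψ D) (z : ℝ) :
    Tendsto (fun t => ψ t + √(D t) * z) atTop atTop := by
  have h1 : ∀ᶠ t in atTop, (ψ (t + (z - 1) / √(D t)) - ψ t) / √(D t) < z :=
    (H.tendsto_inverse_shift (z - 1)).eventually_lt_const (by linarith)
  rw [tendsto_atTop]
  intro X
  filter_upwards [h1, H.pos, eventually_shift H.scale (H.tendsto.eventually_ge_atTop X)
    |z - 1|] with t h1 h2 h3
  have hσ : 0 < √(D t) := Real.sqrt_pos.2 h2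
  rw [div_lt_iff₀ hσ] at h1
  linarith [h3 (z - 1) le_rfl]

/-- After rescaling, `h` is asymptotically linear around `ψ t`. -/
lemma tendsto_rescaled (H : SelfNeglectingInverse h ψ D) (z : ℝ) :
    Tendsto (fun t => √(D t) * (h (ψ t + √(D t) * z) - t)) atTop (𝓝 z) := by
  obtain ⟨X, hX⟩ := H.monotoneOn.exists
  have hmid := (H.tendsto_point_atTop z).eventually_ge_atTop X
  refine tendsto_order.2 ⟨fun a ha => ?_, fun b hb => ?_⟩
  · obtain ⟨w, haw, hwz⟩ := exists_between ha
    filter_upwards [(H.tendsto_inverse_shift w).eventually_lt_const hwz, H.pos, hmid,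
      eventually_shift H.scale (H.tendsto.eventually_ge_atTop X) |w|,
      eventually_shift H.scale H.right_inv |w|] with t h1 h2 h3 h4 h5
    have hσ : 0 < √(D t) := Real.sqrt_pos.2 h2
    rw [div_lt_iff₀ hσ] at h1
    have := hX (h4 w le_rfl) h3 (by linarith)
    rw [h5 w le_rfl] at this
    have h6 : w / √(D t) ≤ h (ψ t + √(D t) * z) - t := by linarith
    rw [div_le_iff₀ hσ] at h6
    linarith
  · obtain ⟨w, hzw, hwb⟩ := exists_between hb
    filter_upwards [(H.tendsto_inverse_shift w).eventually_const_lt hzw, H.pos, hmid,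
      eventually_shift H.scale (H.tendsto.eventually_ge_atTop X) |w|,
      eventually_shift H.scale H.right_inv |w|] with t h1 h2 h3 h4 h5
    have hσ : 0 < √(D t) := Real.sqrt_pos.2 h2
    rw [lt_div_iff₀ hσ] at h1
    have := hX h3 (h4 w le_rfl) (by linarith)
    rw [h5 w le_rfl] at this
    have h6 : h (ψ t + √(D t) * z) - t ≤ w / √(D t) := by linarith
    rw [le_div_iff₀ hσ] at h6
    linarith

/-- The rescaled exponent converges to that of the standard Gaussian density. -/
lemma tendsto_exponent (H : SelfNeglectingInverse h ψ D) {g : ℝ → ℝ}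
    (hg : ∀ x, HasDerivAt g (h x) x) (y : ℝ) :
    Tendsto (fun t => t * (√(D t) * y) - (g (ψ t + √(D t) * y) - g (ψ t))) atTop
      (𝓝 (-(y ^ 2 / 2))) := by
  obtain ⟨X, hX⟩ := H.monotoneOn.exists
  have hmono : ∀ᶠ t in atTop,
      MonotoneOn (fun z => √(D t) * (h (ψ t + √(D t) * z) - t)) (Icc (-|y|) |y|) := by
    filter_upwards [(H.tendsto_point_atTop (-|y|)).eventually_ge_atTop X] with t ht a ha b hb hab
    have hσ := Real.sqrt_nonneg (D t)
    have h1 : √(D t) * -|y| ≤ √(D t) * a := mul_le_mul_of_nonneg_left ha.1 hσ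
    have h2 : √(D t) * a ≤ √(D t) * b := mul_le_mul_of_nonneg_left hab hσ
    refine mul_le_mul_of_nonneg_left ?_ hσ
    have := hX (a := ψ t + √(D t) * a) (b := ψ t + √(D t) * b)
      (by rw [mem_Ici]; linarith) (by rw [mem_Ici]; linarith) (by linarith)
    linarith
  have hsub : uIcc 0 y ⊆ Icc (-|y|) |y| := by
    intro z hz
    rw [mem_uIcc] at hz
    rcases hz with hz | hz
    · exact ⟨by linarith [abs_nonneg y], hz.2.trans (le_abs_self y)⟩
    · exact ⟨(neg_abs_le y).trans hz.1, hz.2.trans (abs_nonneg y)⟩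
  have hint : ∀ᶠ t in atTop, IntervalIntegrable
      (fun z => √(D t) * (h (ψ t + √(D t) * z) - t)) volume 0 y := by
    filter_upwards [hmono] with t ht
    exact (ht.mono hsub).intervalIntegrable
  have hlim : Tendsto (fun t => ∫ z in (0:ℝ)..y, √(D t) * (h (ψ t + √(D t) * z) - t)) atTop
      (𝓝 (∫ z in (0:ℝ)..y, z)) := by
    refine intervalIntegral.tendsto_integral_filter_of_dominated_convergence
      (fun _ => |y| + 1) ?_ ?_ (by simp) ?_
    · filter_upwards [hint] with t ht
      exact ht.aestronglyMeasurable_restrict_uIoc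
    · filter_upwards [hmono,
        (H.tendsto_rescaled (-|y|)).eventually_const_lt (show -|y| - 1 < -|y| by linarith),
        (H.tendsto_rescaled |y|).eventually_lt_const (show |y| < |y| + 1 by linarith)]
        with t h1 h2 h3
      refine Eventually.of_forall fun z hz => ?_
      have hz' := hsub (uIoc_subset_uIcc hz)
      have hy : -|y| ≤ |y| := by linarith [abs_nonneg y]
      have h4 := h1 (left_mem_Icc.2 hy) hz' hz'.1
      have h5 := h1 hz' (right_mem_Icc.2 hy) hz'.2
      simp only at h4 h5
      rw [Real.norm_eq_abs, abs_le]
      constructor <;> linarith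
    · exact Eventually.of_forall fun z _ => H.tendsto_rescaled z
  rw [integral_id] at hlim
  have hlim' := hlim.neg
  have e : -((y ^ 2 - 0 ^ 2) / 2) = -(y ^ 2 / 2) := by ring
  rw [e] at hlim'
  refine hlim'.congr' ?_
  filter_upwards [hint] with t ht
  rw [intervalIntegral.integral_eq_sub_of_hasDerivAt
    (f := fun z => g (ψ t + √(D t) * z) - t * (√(D t) * z)) ?_ ht]
  · simp only [mul_zero, add_zero, sub_zero]
    ring
  · intro z _
    have hd : HasDerivAt (fun z : ℝ => √(D t) * z) (√(D t)) z := by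
      simpa using (hasDerivAt_id z).const_mul (√(D t))
    have := (HasDerivAt.comp z (hg _) (hd.const_add (ψ t))).sub (hd.const_mul t)
    refine this.congr_deriv ?_
    ring

/-- The rescaled exponent is dominated by a two-sided exponential. -/
lemma exponent_le (H : SelfNeglectingInverse h ψ D) {g : ℝ → ℝ}
    (hg : ∀ x, HasDerivAt g (h x) x) {X : ℝ} (hX : MonotoneOn h (Ici X)) :
    ∀ᶠ t in atTop, ∀ y, X ≤ ψ t + √(D t) * y →
      t * (√(D t) * y) - (g (ψ t + √(D t) * y) - g (ψ t)) ≤ 1 / 4 - |y| / 4 := by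
  have hgd : deriv g = h := funext fun x => (hg x).deriv
  have hconv : ConvexOn ℝ (Ici X) g := by
    refine MonotoneOn.convexOn_of_deriv (convex_Ici X)
      (fun x _ => (hg x).continuousAt.continuousWithinAt)
      (fun x _ => (hg x).differentiableAt.differentiableWithinAt) ?_
    rw [hgd]
    exact hX.mono interior_subset
  have l1 := (H.tendsto_exponent hg 1).eventually_le_const (u := -(1/4)) (by norm_num)
  have l2 := (H.tendsto_exponent hg (-1)).eventually_le_const (u := -(1/4)) (by norm_num)
  filter_upwards [l1, l2, H.pos, H.tendsto.eventually_ge_atTop X, H.right_inv,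
    (H.tendsto_point_atTop (-1)).eventually_ge_atTop X] with t h1 h2 h3 h4 h5 h6 y hy
  have hσ : 0 < √(D t) := Real.sqrt_pos.2 h3
  have hcomb : ∀ θ : ℝ, 0 ≤ θ → θ ≤ 1 →
      g (ψ t + √(D t) * (θ * y)) ≤ θ * g (ψ t + √(D t) * y) + (1 - θ) * g (ψ t) := by
    intro θ h0 h1
    have := hconv.2 (x := ψ t + √(D t) * y) (y := ψ t) hy h4 h0 (sub_nonneg.2 h1) (by ring)
    simp only [smul_eq_mul] at this
    refine le_trans (le_of_eq ?_) this
    congr 1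
    ring
  rcases le_or_gt 1 |y| with hy1 | hy1
  · have hyp : 0 < |y| := by linarith
    have h7 := hcomb (1 / |y|) (by positivity) (by rw [div_le_one hyp]; exact hy1)
    have h8 : t * (√(D t) * (1 / |y| * y)) -
        (g (ψ t + √(D t) * (1 / |y| * y)) - g (ψ t)) ≤ -(1/4) := by
      rcases le_or_gt 0 y with hs | hs
      · have hy0 : y ≠ 0 := by rintro rfl; simp at hyp
        rw [abs_of_nonneg hs, one_div_mul_cancel hy0]
        exact h1
      · rw [abs_of_neg hs, show 1 / -y * y = -1 by
          rw [one_div, inv_neg, neg_mul, inv_mul_cancel₀ hs.ne]]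
        exact h2
    have h9 : (1 / |y|) * (t * (√(D t) * y) - (g (ψ t + √(D t) * y) - g (ψ t))) ≤ -(1/4) := by
      linarith
    rw [one_div_mul_eq_div, div_le_iff₀ hyp] at h9
    linarith
  · suffices t * (√(D t) * y) - (g (ψ t + √(D t) * y) - g (ψ t)) ≤ 0 by linarith
    have hslope : (g (ψ t + √(D t) * y) - g (ψ t)) ≥ t * (√(D t) * y) := by
      rcases lt_trichotomy y 0 with hs | hs | hs
      · have hneg : √(D t) * y < 0 := mul_neg_of_pos_of_neg hσ hs
        have := hconv.slope_le_of_hasDerivAt hy h4 (by linarith) (hg (ψ t))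
        rw [slope_def_field, h5, div_le_iff₀ (by linarith)] at this
        linarith
      · simp [hs]
      · have hpos : 0 < √(D t) * y := mul_pos hσ hs
        have := hconv.le_slope_of_hasDerivAt h4 hy (by linarith) (hg (ψ t))
        rw [slope_def_field, h5, le_div_iff₀ (by linarith)] at this
        linarith
    linarith

end SelfNeglectingInverse

lemma integrable_sq_mul_exp_neg_half_sq :
    Integrable fun y : ℝ => y ^ 2 * Real.exp (-(y ^ 2 / 2)) := by
  have := integrable_rpow_mul_exp_neg_mul_sq (b := 1 / 2) (by norm_num) (s := 2) (by norm_num)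
  refine this.congr (Eventually.of_forall fun y => ?_)
  simp only [Real.rpow_two]
  congr 2
  ring

lemma integrable_exp_neg_half_sq : Integrable fun y : ℝ => Real.exp (-(y ^ 2 / 2)) := by
  refine (integrable_exp_neg_mul_sq (b := 1 / 2) (by norm_num)).congr
    (Eventually.of_forall fun y => ?_)
  simp only
  congr 1
  ring

lemma integrable_mul_exp_neg_half_sq : Integrable fun y : ℝ => y * Real.exp (-(y ^ 2 / 2)) := by
  refine (integrable_mul_exp_neg_mul_sq (b := 1 / 2) (by norm_num)).congr
    (Eventually.of_forall fun y => ?_)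
  simp only
  congr 2
  ring

lemma hasDerivAt_exp_neg_half_sq (y : ℝ) :
    HasDerivAt (fun y : ℝ => Real.exp (-(y ^ 2 / 2))) (-(y * Real.exp (-(y ^ 2 / 2)))) y := by
  have h1 : HasDerivAt (fun y : ℝ => -(y ^ 2 / 2)) (-y) y := by
    refine (((hasDerivAt_id y).pow 2).div_const 2).neg.congr_deriv ?_
    simp
  exact h1.exp.congr_deriv (by ring)

lemma integral_mul_exp_neg_half_sq : ∫ y : ℝ, y * Real.exp (-(y ^ 2 / 2)) = 0 := by
  have := integral_eq_zero_of_hasDerivAt_of_integrable hasDerivAt_exp_neg_half_sq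
    integrable_mul_exp_neg_half_sq.neg integrable_exp_neg_half_sq
  rw [integral_neg] at this
  linarith

lemma integral_sq_mul_exp_neg_half_sq :
    ∫ y : ℝ, y ^ 2 * Real.exp (-(y ^ 2 / 2)) = ∫ y : ℝ, Real.exp (-(y ^ 2 / 2)) := by
  have hd : ∀ y : ℝ, HasDerivAt (fun y : ℝ => y * Real.exp (-(y ^ 2 / 2)))
      (Real.exp (-(y ^ 2 / 2)) - y ^ 2 * Real.exp (-(y ^ 2 / 2))) y := fun y => by
    refine ((hasDerivAt_id y).mul (hasDerivAt_exp_neg_half_sq y)).congr_deriv ?_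
    simp only [id]
    ring
  have := integral_eq_zero_of_hasDerivAt_of_integrable hd
    (integrable_exp_neg_half_sq.sub integrable_sq_mul_exp_neg_half_sq)
    integrable_mul_exp_neg_half_sq
  rw [integral_sub integrable_exp_neg_half_sq integrable_sq_mul_exp_neg_half_sq] at this
  linarith

lemma integral_exp_neg_half_sq_pos : 0 < ∫ y : ℝ, Real.exp (-(y ^ 2 / 2)) := by
  rw [integral_pos_iff_support_of_nonneg (fun y => (Real.exp_pos _).le) integrable_exp_neg_half_sq]
  have : Function.support (fun y : ℝ => Real.exp (-(y ^ 2 / 2))) = univ := by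
    ext y
    simp [(Real.exp_pos _).ne']
  simp [this]

lemma abs_pow_le_one_add_sq (r : ℝ) {n : ℕ} (hn : n ≤ 2) : |r ^ n| ≤ 1 + r ^ 2 := by
  have := sq_abs r
  rw [abs_pow]
  interval_cases n
  · nlinarith [sq_nonneg r]
  · nlinarith [sq_nonneg (|r| - 1)]
  · linarith

lemma one_add_sq_mul_exp_le {r : ℝ} (hr : 0 ≤ r) : (1 + r ^ 2) * Real.exp (-(r / 8)) ≤ 129 := by
  have h1 := Real.one_le_exp (x := r / 8) (by positivity)
  have h2 := Real.pow_div_factorial_le_exp (r / 8) (by positivity) 2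
  rw [Real.exp_neg, ← div_eq_mul_inv, div_le_iff₀ (Real.exp_pos _)]
  norm_num [Nat.factorial] at h2
  nlinarith

lemma abs_pow_mul_exp_le (y : ℝ) {n : ℕ} (hn : n ≤ 2) :
    |y ^ n| * Real.exp (5 / 4 - |y| / 4) ≤ (12290 * Real.exp (5 / 4)) * (1 + y ^ 2)⁻¹ := by
  have h0 := abs_nonneg y
  have h1 := Real.one_le_exp (x := |y| / 4) (by positivity)
  have h2 := Real.pow_div_factorial_le_exp (|y| / 4) (by positivity) 4
  norm_num [Nat.factorial] at h2
  have h3 : |y| ^ 4 = (y ^ 2) ^ 2 := by rw [← sq_abs y]; ring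
  have h4 : (1 + y ^ 2) ^ 2 ≤ 12290 * Real.exp (|y| / 4) := by
    have : (|y| / 4) ^ 4 = (y ^ 2) ^ 2 / 256 := by rw [div_pow, h3]; norm_num
    rw [this] at h2
    nlinarith [sq_nonneg (y ^ 2 - 1)]
  have h5 := abs_pow_le_one_add_sq y hn
  have h6 : 0 < 1 + y ^ 2 := by positivity
  rw [← div_eq_mul_inv, le_div_iff₀ h6, sub_eq_add_neg, Real.exp_add, Real.exp_neg]
  calc |y ^ n| * (Real.exp (5 / 4) * (Real.exp (|y| / 4))⁻¹) * (1 + y ^ 2)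
      ≤ (1 + y ^ 2) * (Real.exp (5 / 4) * (Real.exp (|y| / 4))⁻¹) * (1 + y ^ 2) := by gcongr
    _ = Real.exp (5 / 4) * ((1 + y ^ 2) ^ 2 * (Real.exp (|y| / 4))⁻¹) := by ring
    _ ≤ Real.exp (5 / 4) * ((12290 * Real.exp (|y| / 4)) * (Real.exp (|y| / 4))⁻¹) := by gcongr
    _ = _ := by field_simp

namespace SelfNeglectingInverse

variable {h ψ D : ℝ → ℝ}

/-- The part of the rescaled tilted moments carried by a fixed bounded interval vanishes. -/
lemma tendsto_head (H : SelfNeglectingInverse h ψ D) {p g : ℝ → ℝ} {c : ℝ} (hc : 0 < c)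
    (hg : ∀ x, HasDerivAt g (h x) x) (hp0 : ∀ x ≥ (0:ℝ), 0 ≤ p x)
    (hint : IntegrableOn p (Ici 0)) {X : ℝ} (hX0 : 0 ≤ X) (hX : MonotoneOn h (Ici X))
    {n : ℕ} (hn : n ≤ 2) :
    Tendsto (fun t => (∫ x in Ico 0 X, ((x - ψ t) / √(D t)) ^ n * (Real.exp (t * x) * p x)) /
      (c * √(D t) * Real.exp (t * ψ t - g (ψ t)))) atTop (𝓝 0) := by
  set P := ∫ x in Ico 0 X, p x
  have hP : 0 ≤ P := setIntegral_nonneg measurableSet_Ico fun x hx => hp0 x hx.1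
  set C := P * 129 * Real.exp (1 / 4 + g (X + 1)) / c
  have hlim : Tendsto (fun t : ℝ => C * (t ^ 1 * Real.exp (-t))) atTop (𝓝 0) := by
    simpa using (Real.tendsto_pow_mul_exp_neg_atTop_nhds_zero 1).const_mul C
  refine squeeze_zero_norm' ?_ hlim
  filter_upwards [H.exponent_le hg hX, H.pos, H.tendsto.eventually_ge_atTop (2 * (X + 1)),
    H.scale.eventually_ge_atTop 1, eventually_gt_atTop 0] with t h1 h2 h3 h4 h5
  set σ := √(D t)
  have hσ : 0 < σ := Real.sqrt_pos.2 h2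
  set r := ψ t / σ
  have hψ : 0 < ψ t := by linarith
  have hr : 0 < r := div_pos hψ hσ
  have hb : ‖∫ x in Ico 0 X, ((x - ψ t) / σ) ^ n * (Real.exp (t * x) * p x)‖ ≤
      ((1 + r ^ 2) * Real.exp (t * X)) * P := by
    rw [← integral_const_mul]
    refine norm_integral_le_of_norm_le
      ((hint.mono_set Ico_subset_Ici_self).const_mul _) ?_
    filter_upwards [ae_restrict_mem measurableSet_Ico] with x hx
    have hpx := hp0 x hx.1
    rw [norm_mul, norm_mul, Real.norm_eq_abs, Real.norm_eq_abs, Real.norm_eq_abs,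
      abs_of_nonneg hpx, Real.abs_exp, ← mul_assoc]
    refine mul_le_mul_of_nonneg_right ?_ hpx
    refine mul_le_mul ?_ ?_ (Real.exp_pos _).le (by positivity)
    · refine (abs_pow_le_one_add_sq _ hn).trans ?_
      have : ((x - ψ t) / σ) ^ 2 ≤ r ^ 2 := by
        rw [← sq_abs ((x - ψ t) / σ), abs_div, abs_of_pos hσ]
        refine pow_le_pow_left₀ (by positivity) ?_ 2
        refine div_le_div_of_nonneg_right ?_ hσ.le
        rw [abs_le]
        constructor <;> linarith [hx.1, hx.2]
      linarith
    · exact Real.exp_le_exp.2 (mul_le_mul_of_nonneg_left hx.2.le h5.le)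
  have hy : ψ t + σ * ((X + 1 - ψ t) / σ) = X + 1 := by field_simp; ring
  have h6 := h1 ((X + 1 - ψ t) / σ) (by rw [hy]; linarith)
  rw [hy, show σ * ((X + 1 - ψ t) / σ) = X + 1 - ψ t by field_simp, abs_div, abs_of_pos hσ,
    abs_of_neg (by linarith)] at h6
  have h7 : r / 2 ≤ -(X + 1 - ψ t) / σ := by
    rw [div_div, mul_comm, ← div_div]
    exact div_le_div_of_nonneg_right (by linarith) hσ.le
  have h8 : Real.exp (t * X) ≤ Real.exp (1 / 4 + g (X + 1)) * Real.exp (-(r / 8)) *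
      Real.exp (-t) * Real.exp (t * ψ t - g (ψ t)) := by
    rw [← Real.exp_add, ← Real.exp_add, ← Real.exp_add]
    exact Real.exp_le_exp.2 (by linarith)
  have h9 := one_add_sq_mul_exp_le hr.le
  rw [norm_div, Real.norm_of_nonneg (show 0 ≤ c * σ * Real.exp (t * ψ t - g (ψ t)) by positivity),
    div_le_iff₀ (by positivity)]
  refine hb.trans ?_
  calc ((1 + r ^ 2) * Real.exp (t * X)) * P
      ≤ ((1 + r ^ 2) * (Real.exp (1 / 4 + g (X + 1)) * Real.exp (-(r / 8)) *
      Real.exp (-t) * Real.exp (t * ψ t - g (ψ t)))) * P := by gcongr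
    _ = ((1 + r ^ 2) * Real.exp (-(r / 8))) * (Real.exp (1 / 4 + g (X + 1)) *
      Real.exp (-t) * Real.exp (t * ψ t - g (ψ t)) * P) * 1 := by ring
    _ ≤ 129 * (Real.exp (1 / 4 + g (X + 1)) *
      Real.exp (-t) * Real.exp (t * ψ t - g (ψ t)) * P) * (t * σ) := by gcongr
    _ = _ := by
      simp only [C]
      field_simp

/-- The part of the rescaled tilted moments carried by a half-line converges to the Gaussian
moment. -/
lemma tendsto_tail (H : SelfNeglectingInverse h ψ D) {p g q : ℝ → ℝ} {c : ℝ} (hc : 0 < c)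
    (hg : ∀ x, HasDerivAt g (h x) x)
    (hpdef : ∀ x ≥ (0:ℝ), p x = c * Real.exp (-(g x - q x)))
    (hint : IntegrableOn p (Ici 0))
    (hPhi : ∀ t > (0:ℝ), IntegrableOn (fun x => Real.exp (t * x) * p x) (Set.Ici 0))
    (hq0 : Tendsto q atTop (𝓝 0))
    {X : ℝ} (hX0 : 0 ≤ X) (hX : MonotoneOn h (Ici X)) (hXq : ∀ x ≥ X, q x ≤ 1)
    {n : ℕ} (hn : n ≤ 2) :
    Tendsto (fun t => (∫ x in Ici X, ((x - ψ t) / √(D t)) ^ n * (Real.exp (t * x) * p x)) /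
      (c * √(D t) * Real.exp (t * ψ t - g (ψ t)))) atTop
      (𝓝 (∫ y, y ^ n * Real.exp (-(y ^ 2 / 2)))) := by
  have hp0 : ∀ x ≥ (0:ℝ), 0 ≤ p x := fun x hx => by rw [hpdef x hx]; positivity
  set f : ℝ → ℝ → ℝ := fun t => (Ici X).indicator
    fun x => ((x - ψ t) / √(D t)) ^ n * (Real.exp (t * x) * p x) with hf
  set F : ℝ → ℝ → ℝ := fun t y =>
    f t (ψ t + √(D t) * y) / (c * Real.exp (t * ψ t - g (ψ t))) with hF
  have hfint : ∀ t > 0, Integrable (f t) := fun t ht =>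
    ((integrableOn_rescaled_pow hp0 hint hPhi ht (ψ t) (√(D t)) n).mono_set
      (Ici_subset_Ici.2 hX0)).integrable_indicator measurableSet_Ici
  have hFval : ∀ t y, 0 < D t → X ≤ ψ t + √(D t) * y → F t y = y ^ n *
      Real.exp (t * (√(D t) * y) - (g (ψ t + √(D t) * y) - g (ψ t)) + q (ψ t + √(D t) * y)) := by
    intro t y hD hy
    have hσ : 0 < √(D t) := Real.sqrt_pos.2 hD
    simp only [hF, hf]
    rw [indicator_of_mem (mem_Ici.2 hy), hpdef _ (hX0.trans hy),
      show (ψ t + √(D t) * y - ψ t) / √(D t) = y by field_simp; ring]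
    rw [div_eq_iff (by positivity), mul_assoc (y ^ n), mul_left_comm (Real.exp _) c,
      mul_left_comm (Real.exp _) c, ← Real.exp_add, ← Real.exp_add]
    congr 3
    ring
  have hFzero : ∀ t y, ¬ X ≤ ψ t + √(D t) * y → F t y = 0 := by
    intro t y hy
    simp only [hF, hf]
    rw [indicator_of_notMem (by simpa using hy), zero_div]
  have hlim : Tendsto (fun t => ∫ y, F t y) atTop
      (𝓝 (∫ y, y ^ n * Real.exp (-(y ^ 2 / 2)))) := by
    refine tendsto_integral_filter_of_dominated_convergence
      (fun y => (12290 * Real.exp (5 / 4)) * (1 + y ^ 2)⁻¹) ?_ ?_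
      (integrable_inv_one_add_sq.const_mul _) ?_
    · filter_upwards [H.pos, eventually_gt_atTop 0] with t hD ht
      have hσ : √(D t) ≠ 0 := (Real.sqrt_pos.2 hD).ne'
      exact ((((hfint t ht).comp_add_left (ψ t)).comp_mul_left' hσ).div_const _).aestronglyMeasurable
    · filter_upwards [H.pos, H.exponent_le hg hX] with t hD hexp
      refine Eventually.of_forall fun y => ?_
      by_cases hy : X ≤ ψ t + √(D t) * y
      · rw [hFval t y hD hy, norm_mul, Real.norm_eq_abs, Real.norm_eq_abs, Real.abs_exp]
        refine le_trans ?_ (abs_pow_mul_exp_le y hn)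
        refine mul_le_mul_of_nonneg_left (Real.exp_le_exp.2 ?_) (abs_nonneg _)
        linarith [hexp y hy, hXq _ hy]
      · rw [hFzero t y hy, norm_zero]
        positivity
    · refine Eventually.of_forall fun y => ?_
      have h1 := (H.tendsto_exponent hg y).add (hq0.comp (H.tendsto_point_atTop y))
      rw [add_zero] at h1
      refine (((Real.continuous_exp.tendsto _).comp h1).const_mul (y ^ n)).congr' ?_
      filter_upwards [H.pos, (H.tendsto_point_atTop y).eventually_ge_atTop X] with t hD hy
      rw [hFval t y hD hy]
      rfl
  refine hlim.congr' ?_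
  filter_upwards [H.pos] with t hD
  have hσ : 0 < √(D t) := Real.sqrt_pos.2 hD
  rw [← integral_indicator measurableSet_Ici]
  change ∫ y, F t y = (∫ x, f t x) / (c * √(D t) * Real.exp (t * ψ t - g (ψ t)))
  rw [integral_div,
    Measure.integral_comp_mul_left (fun y => f t (ψ t + y)) (√(D t)),
    integral_add_left_eq_self (f t), smul_eq_mul, abs_of_pos (inv_pos.2 hσ)]
  field_simp

/-- The tilted variance is asymptotic to the derivative of the inverse of `h`. -/
lemma tendsto_s2Fun_div (H : SelfNeglectingInverse h ψ D) {p g q : ℝ → ℝ} {c : ℝ} (hc : 0 < c)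
    (hg : ∀ x, HasDerivAt g (h x) x)
    (hpdef : ∀ x ≥ (0:ℝ), p x = c * Real.exp (-(g x - q x)))
    (hint : IntegrableOn p (Ici 0))
    (hPhi : ∀ t > (0:ℝ), IntegrableOn (fun x => Real.exp (t * x) * p x) (Set.Ici 0))
    (hq0 : Tendsto q atTop (𝓝 0)) :
    Tendsto (fun t => s2Fun p t / D t) atTop (𝓝 1) := by
  have hp0 : ∀ x ≥ (0:ℝ), 0 ≤ p x := fun x hx => by rw [hpdef x hx]; positivity
  obtain ⟨X₁, hX₁⟩ := eventually_atTop.1 (hq0.eventually_le_const (u := 1) one_pos)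
  obtain ⟨X, hX, hX0, hXX₁⟩ := (H.monotoneOn.and
    ((eventually_ge_atTop 0).and (eventually_ge_atTop X₁))).exists
  set Z : ℝ → ℝ := fun t => c * √(D t) * Real.exp (t * ψ t - g (ψ t)) with hZ
  set M : ℝ → ℕ → ℝ := fun t n =>
    ∫ x in Ici (0:ℝ), ((x - ψ t) / √(D t)) ^ n * (Real.exp (t * x) * p x) with hM
  have hN : ∀ n ≤ 2, Tendsto (fun t => M t n / Z t) atTop
      (𝓝 (∫ y, y ^ n * Real.exp (-(y ^ 2 / 2)))) := by
    intro n hn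
    have := (H.tendsto_head hc hg hp0 hint hX0 hX hn).add
      (H.tendsto_tail hc hg hpdef hint hPhi hq0 hX0 hX (fun x hx => hX₁ x (hXX₁.trans hx)) hn)
    rw [zero_add] at this
    refine this.congr' ?_
    filter_upwards [eventually_gt_atTop 0] with t ht
    rw [← add_div]
    congr 1
    have hi := integrableOn_rescaled_pow hp0 hint hPhi ht (ψ t) (√(D t)) n
    rw [← setIntegral_union _ measurableSet_Ici (hi.mono_set Ico_subset_Ici_self)
      (hi.mono_set (Ici_subset_Ici.2 hX0)), Ico_union_Ici_eq_Ici hX0]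
    exact disjoint_left.2 fun x hx hx' => absurd hx.2 (not_lt.2 hx')
  have h0 := hN 0 (by norm_num)
  have h1 := hN 1 (by norm_num)
  have h2 := hN 2 le_rfl
  simp only [pow_zero, one_mul, pow_one] at h0 h1
  rw [integral_mul_exp_neg_half_sq] at h1
  rw [integral_sq_mul_exp_neg_half_sq] at h2
  have hpos := integral_exp_neg_half_sq_pos
  set I := ∫ y : ℝ, Real.exp (-(y ^ 2 / 2))
  have hlim := (h2.div h0 hpos.ne').sub ((h1.div h0 hpos.ne').pow 2)
  rw [div_self hpos.ne', zero_div, zero_pow two_ne_zero, sub_zero] at hlim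
  refine hlim.congr' ?_
  filter_upwards [H.pos, eventually_gt_atTop 0, h0.eventually_const_lt hpos] with t hD ht hM0
  have hσ : 0 < √(D t) := Real.sqrt_pos.2 hD
  have hZt : 0 < Z t := by simp only [hZ]; positivity
  have hM0' : M t 0 ≠ 0 := fun h => by simp [h] at hM0
  rw [s2Fun_eq_rescaled hp0 hint hPhi ht (ψ t) hσ (M := M t) (fun n => rfl) hM0',
    Real.sq_sqrt hD.le]
  simp only [Pi.div_apply]
  field_simp

lemma tendsto_h (H : SelfNeglectingInverse h ψ D) : Tendsto h atTop atTop := by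
  obtain ⟨X, hX⟩ := H.monotoneOn.exists
  rw [Filter.tendsto_atTop]
  intro b
  obtain ⟨t, h1, h2, h3⟩ := (H.right_inv.and
    ((H.tendsto.eventually_ge_atTop X).and (eventually_ge_atTop b))).exists
  filter_upwards [eventually_ge_atTop (ψ t)] with x hx
  have := hX h2 (h2.trans hx) hx
  linarith

/-- A function asymptotic to `D` inherits the self-neglecting property of `D`. -/
lemma ratio_uniform (H : SelfNeglectingInverse h ψ D) {S : ℝ → ℝ}
    (hS : Tendsto (fun t => S t / D t) atTop (𝓝 1)) (A : ℝ) {ε : ℝ} (hε : 0 < ε) :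
    ∀ᶠ t in atTop, ∀ u, |u| ≤ A → |S (t + u / √(S t)) / S t - 1| < ε := by
  have hcont : Tendsto (fun z : ℝ × ℝ × ℝ => z.1 * z.2.1 / z.2.2) (𝓝 (1, 1, 1)) (𝓝 1) := by
    have : ContinuousAt (fun z : ℝ × ℝ × ℝ => z.1 * z.2.1 / z.2.2) (1, 1, 1) := by
      refine ContinuousAt.div (by fun_prop) (by fun_prop) (by norm_num)
    simpa [ContinuousAt] using this
  obtain ⟨δ, hδ, hδε⟩ := Metric.tendsto_nhds_nhds.1 hcont ε hε
  have hclose : ∀ᶠ t in atTop, |S t / D t - 1| < min δ (3 / 4) :=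
    (Metric.tendsto_nhds.1 hS (min δ (3 / 4)) (by positivity)).mono fun t ht => by
      rwa [Real.dist_eq] at ht
  filter_upwards [hclose, H.pos, H.neglect (2 * A) δ hδ,
    eventually_shift H.scale hclose (2 * A), eventually_shift H.scale H.pos (2 * A)]
    with t h1 h2 h3 h4 h5 u hu
  have h1' := abs_lt.1 (h1.trans_le (min_le_right _ _))
  have hSD : 1 / 4 < S t / D t := by linarith
  have hSpos : 0 < S t := by
    rw [lt_div_iff₀ h2] at hSD
    linarith
  have hσ : 0 < √(D t) := Real.sqrt_pos.2 h2
  have hτ : 0 < √(S t) := Real.sqrt_pos.2 hSpos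
  set u' := u * √(D t) / √(S t)
  have hu' : u / √(S t) = u' / √(D t) := by
    simp only [u']
    field_simp
  have hu'A : |u'| ≤ 2 * A := by
    have hle : √(D t) ≤ 2 * √(S t) := by
      have h6 : D t ≤ 2 ^ 2 * S t := by
        rw [lt_div_iff₀ h2] at hSD
        linarith
      calc √(D t) ≤ √(2 ^ 2 * S t) := Real.sqrt_le_sqrt h6
        _ = 2 * √(S t) := by rw [Real.sqrt_mul (by positivity), Real.sqrt_sq (by norm_num)]
    simp only [u']
    rw [abs_div, abs_mul, abs_of_pos hσ, abs_of_pos hτ, div_le_iff₀ hτ]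
    nlinarith [abs_nonneg u]
  rw [hu']
  have k1 := (h4 u' hu'A).trans_le (min_le_left _ _)
  have k2 := h3 u' hu'A
  have k3 := h1.trans_le (min_le_left _ _)
  have k4 := h5 u' hu'A
  set s := t + u' / √(D t)
  have := hδε (x := (S s / D s, D s / D t, S t / D t)) (by
    simp only [Prod.dist_eq, Real.dist_eq]
    exact max_lt k1 (max_lt k2 k3))
  rw [Real.dist_eq] at this
  convert this using 3
  field_simp

end SelfNeglectingInverse

/-- `ψ` is a right inverse of `h` near infinity whose logarithmic derivative is `e t / t`, with `e`
of bounded logarithmic index. -/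
structure RegularInverse (h ψ e e' : ℝ → ℝ) : Prop where
  tendsto : Tendsto ψ atTop atTop
  right_inv : ∀ᶠ t in atTop, h (ψ t) = t
  monotoneOn : ∀ᶠ X in atTop, MonotoneOn h (Ici X)
  hasDerivAt : ∀ᶠ t in atTop, HasDerivAt ψ (ψ t * e t / t) t
  hasDerivAt_index : ∀ᶠ t in atTop, HasDerivAt e (e' t) t
  index_pos : ∀ᶠ t in atTop, 0 < e t
  index_bound : ∃ C : ℝ, ∀ᶠ t in atTop, |t * e' t| ≤ C * e t
  scale : Tendsto (fun t => t * e t * ψ t) atTop atTop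
  index_small : Tendsto (fun t => e t / (t * ψ t)) atTop (𝓝 0)

namespace RegularInverse

variable {h ψ e e' : ℝ → ℝ}

lemma log_sub_log_le {f f' : ℝ → ℝ} {s : Set ℝ} (hs : Convex ℝ s) {B : ℝ}
    (hf : ∀ x ∈ s, HasDerivAt f (f' x) x) (hpos : ∀ x ∈ s, 0 < f x)
    (hB : ∀ x ∈ s, |f' x| ≤ B * f x) {x y : ℝ} (hx : x ∈ s) (hy : y ∈ s) :
    |Real.log (f y) - Real.log (f x)| ≤ B * |y - x| := by
  refine hs.norm_image_sub_le_of_norm_hasDerivWithin_le (f := fun x => Real.log (f x))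
    (f' := fun x => f' x / f x)
    (fun z hz => ((hf z hz).log (hpos z hz).ne').hasDerivWithinAt) (fun z hz => ?_) hx hy
  rw [norm_div, Real.norm_eq_abs, Real.norm_of_nonneg (hpos z hz).le, div_le_iff₀ (hpos z hz)]
  exact hB z hz

lemma tendsto_scale (H : RegularInverse h ψ e e') :
    Tendsto (fun t => t * √(ψ t * e t / t)) atTop atTop := by
  refine (Real.tendsto_sqrt_atTop.comp H.scale).congr' ?_
  filter_upwards [eventually_gt_atTop 0] with t ht
  simp only [Function.comp]
  rw [show t * e t * ψ t = t ^ 2 * (ψ t * e t / t) by field_simp, Real.sqrt_mul (by positivity),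
    Real.sqrt_sq ht.le]

lemma neglect (H : RegularInverse h ψ e e') (A : ℝ) {ε : ℝ} (hε : 0 < ε) :
    ∀ᶠ t in atTop, ∀ u, |u| ≤ A →
      |ψ (t + u / √(ψ t * e t / t)) * e (t + u / √(ψ t * e t / t)) / (t + u / √(ψ t * e t / t)) /
        (ψ t * e t / t) - 1| < ε := by
  obtain ⟨C, hC⟩ := H.index_bound
  obtain ⟨T, hT⟩ := eventually_atTop.1 ((H.tendsto.eventually_gt_atTop 0).and
    (H.hasDerivAt.and (H.hasDerivAt_index.and (H.index_pos.and (hC.and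
      (eventually_gt_atTop (0:ℝ)))))))
  have hC0 : 0 ≤ C := by
    obtain ⟨-, -, -, h4, h5, -⟩ := hT T le_rfl
    by_contra hn
    nlinarith [abs_nonneg (T * e' T)]
  obtain ⟨δ, hδ, hδε⟩ := Metric.tendsto_nhds_nhds.1
    (Real.continuous_exp.tendsto 0) ε hε
  rw [Real.exp_zero] at hδε
  have hlim : Tendsto (fun t => 2 * A * (Real.exp (2 * C) * √(e t / (t * ψ t)) +
      (C + 1) * (t * √(ψ t * e t / t))⁻¹)) atTop (𝓝 0) := by
    have h1 := (Real.continuous_sqrt.tendsto 0).comp H.index_small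
    rw [Real.sqrt_zero] at h1
    simpa using ((h1.const_mul (Real.exp (2 * C))).add
      (H.tendsto_scale.inv_tendsto_atTop.const_mul (C + 1))).const_mul (2 * A)
  filter_upwards [SelfNeglectingInverse.eventually_half_le (D := fun t => ψ t * e t / t)
    H.tendsto_scale A, eventually_ge_atTop (2 * T), hlim.eventually_lt_const hδ] with t h1 h2 h3 u hu
  obtain ⟨-, -, -, -, -, hT0⟩ := hT T le_rfl
  obtain ⟨hψ, -, -, he, -, ht⟩ := hT t (by linarith)
  have hD : 0 < ψ t * e t / t := by positivity
  set σ := √(ψ t * e t / t)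
  have hσ : 0 < σ := Real.sqrt_pos.2 hD
  have h1' := h1 u hu
  set s := t + u / σ with hs
  have hts : |s - t| ≤ t / 2 := by simpa [hs] using h1'
  have hI : ∀ x ∈ Icc (t / 2) (3 * t / 2), T ≤ x := fun x hx => by linarith [hx.1]
  have htI : t ∈ Icc (t / 2) (3 * t / 2) := ⟨by linarith, by linarith⟩
  have hsI : s ∈ Icc (t / 2) (3 * t / 2) := by
    have := abs_le.1 hts
    exact ⟨by linarith, by linarith⟩
  have hinv : ∀ x ∈ Icc (t / 2) (3 * t / 2), 1 / x ≤ 2 / t := fun x hx => by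
    rw [div_le_div_iff₀ (by linarith [hx.1]) ht]
    linarith [hx.1]
  have hebd : ∀ x ∈ Icc (t / 2) (3 * t / 2), |e' x| ≤ (C * (2 / t)) * e x := by
    intro x hx
    obtain ⟨-, -, -, hex, hcx, hx0⟩ := hT x (hI x hx)
    rw [abs_mul, abs_of_pos hx0] at hcx
    calc |e' x| = (1 / x) * (x * |e' x|) := by field_simp
      _ ≤ (2 / t) * (C * e x) := mul_le_mul (hinv x hx) hcx (by positivity) (by positivity)
      _ = _ := by ring
  have hecomp : ∀ x ∈ Icc (t / 2) (3 * t / 2), e x ≤ Real.exp (2 * C) * e t := by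
    intro x hx
    have hex := (hT x (hI x hx)).2.2.2.1
    have := log_sub_log_le (convex_Icc (t / 2) (3 * t / 2)) (fun z hz => (hT z (hI z hz)).2.2.1)
      (fun z hz => (hT z (hI z hz)).2.2.2.1) hebd htI hx
    have hxt : |x - t| ≤ t := by
      rw [abs_le]
      constructor <;> linarith [hx.1, hx.2]
    have h6 : C * (2 / t) * |x - t| ≤ 2 * C := by
      calc C * (2 / t) * |x - t| ≤ C * (2 / t) * t := by gcongr
        _ = 2 * C := by field_simp
    have h7 : Real.log (e x) ≤ 2 * C + Real.log (e t) := by linarith [(abs_le.1 this).2]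
    rw [← Real.exp_log hex, ← Real.exp_log he, ← Real.exp_add]
    exact Real.exp_le_exp.2 h7
  have hmain := log_sub_log_le (f := fun x => ψ x * e x / x)
    (f' := fun x => ((ψ x * e x / x * e x + ψ x * e' x) * x - ψ x * e x * 1) / x ^ 2)
    (B := (Real.exp (2 * C) * e t + C + 1) * (2 / t))
    (convex_Icc (t / 2) (3 * t / 2)) (fun x hx => ?_) (fun x hx => ?_) (fun x hx => ?_) htI hsI
  rotate_left
  · obtain ⟨-, hd, hde, -, -, hx0⟩ := hT x (hI x hx)
    exact (hd.mul hde).div (hasDerivAt_id x) hx0.ne'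
  · obtain ⟨hψx, -, -, hex, -, hx0⟩ := hT x (hI x hx)
    positivity
  · obtain ⟨hψx, -, -, hex, hcx, hx0⟩ := hT x (hI x hx)
    have e1 : ((ψ x * e x / x * e x + ψ x * e' x) * x - ψ x * e x * 1) / x ^ 2 =
        (ψ x / x) * (1 / x) * (e x * e x + x * e' x - e x) := by
      field_simp
    have e2 : |e x * e x + x * e' x - e x| ≤ (Real.exp (2 * C) * e t + C + 1) * e x := by
      have h8 := mul_le_mul_of_nonneg_right (hecomp x hx) hex.le
      have h9 := abs_le.1 hcx
      have h10 : 0 ≤ e x * e x := by positivity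
      rw [abs_le]
      constructor <;> nlinarith
    rw [e1, abs_mul, abs_of_pos (by positivity : 0 < (ψ x / x) * (1 / x))]
    calc (ψ x / x) * (1 / x) * |e x * e x + x * e' x - e x|
        ≤ (ψ x / x) * (2 / t) * ((Real.exp (2 * C) * e t + C + 1) * e x) := by
          have := hinv x hx
          gcongr
      _ = _ := by ring
  have hst : |s - t| ≤ A / σ := by
    rw [hs, add_sub_cancel_left, abs_div, abs_of_pos hσ]
    exact div_le_div_of_nonneg_right hu hσ.le
  have hroot : e t / (t * σ) = √(e t / (t * ψ t)) := by
    rw [eq_comm, Real.sqrt_eq_iff_mul_self_eq (by positivity) (by positivity)]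
    have : σ ^ 2 = ψ t * e t / t := Real.sq_sqrt hD.le
    have e3 : e t / (t * σ) * (e t / (t * σ)) = e t ^ 2 / (t ^ 2 * σ ^ 2) := by ring
    rw [e3, this]
    field_simp
  have hfin : |Real.log (ψ s * e s / s) - Real.log (ψ t * e t / t)| < δ := by
    refine hmain.trans_lt (lt_of_le_of_lt ?_ h3)
    calc (Real.exp (2 * C) * e t + C + 1) * (2 / t) * |s - t|
        ≤ (Real.exp (2 * C) * e t + C + 1) * (2 / t) * (A / σ) := by gcongr
      _ = 2 * A * (Real.exp (2 * C) * (e t / (t * σ)) + (C + 1) * (t * σ)⁻¹) := by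
        field_simp
        ring
      _ = _ := by rw [hroot]
  obtain ⟨hψs, -, -, hes, -, hs0⟩ := hT s (hI s hsI)
  have hDs : 0 < ψ s * e s / s := by positivity
  have := hδε (x := Real.log (ψ s * e s / s) - Real.log (ψ t * e t / t)) (by
    rwa [Real.dist_eq, sub_zero])
  rwa [Real.exp_sub, Real.exp_log hDs, Real.exp_log hD, Real.dist_eq] at this

lemma selfNeglectingInverse (H : RegularInverse h ψ e e') :
    SelfNeglectingInverse h ψ (fun t => ψ t * e t / t) where
  tendsto := H.tendsto
  right_inv := H.right_inv
  hasDerivAt := H.hasDerivAt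
  pos := by
    filter_upwards [H.index_pos, H.tendsto.eventually_gt_atTop 0, eventually_gt_atTop 0]
      with t h1 h2 h3
    positivity
  monotoneOn := H.monotoneOn
  scale := H.tendsto_scale
  neglect := fun A _ hε => H.neglect A hε

end RegularInverse

lemma hasDerivAt_exp_integral_div {ε : ℝ → ℝ} (hε : Continuous ε) {x : ℝ} (hx : 1 < x) :
    HasDerivAt (fun x => Real.exp (∫ u in (1:ℝ)..x, ε u / u))
      (Real.exp (∫ u in (1:ℝ)..x, ε u / u) * (ε x / x)) x := by
  refine (intervalIntegral.integral_hasDerivAt_right ?_ ?_ ?_).exp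
  · refine ContinuousOn.intervalIntegrable fun u hu => ?_
    rw [uIcc_of_le hx.le] at hu
    exact (hε.continuousAt.div continuousAt_id (by
      simp only [id]
      linarith [hu.1])).continuousWithinAt
  · exact (hε.measurable.div measurable_id).stronglyMeasurable.stronglyMeasurableAtFilter
  · exact hε.continuousAt.div continuousAt_id (by linarith)

/-- If the derivative `h` of `g` is strictly increasing on `[0, ∞)`, its generalized inverse is a
right inverse wherever it is positive. -/
lemma apply_geninv {g h : ℝ → ℝ} (hg : ∀ x, HasDerivAt g (h x) x)
    (hmono : StrictMonoOn h (Ici 0)) {t : ℝ} (hpos : 0 < geninv h t) : h (geninv h t) = t := by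
  set x := geninv h t with hx
  set S : Set ℝ := {x : ℝ | t ≤ h x} with hS
  have hxS : x = sInf S := rfl
  have hne : S.Nonempty := by
    by_contra hn
    rw [hxS, not_nonempty_iff_eq_empty.1 hn, Real.sInf_empty] at hpos
    exact lt_irrefl _ hpos
  have hbdd : BddBelow S := by
    by_contra hn
    rw [hxS, Real.sInf_of_not_bddBelow hn] at hpos
    exact lt_irrefl _ hpos
  have hlow : ∀ y < x, h y < t := fun y hy => by
    by_contra! hn
    exact absurd (csInf_le hbdd (show y ∈ S from hn)) (not_le.2 hy)
  have hhigh : ∀ y > x, t ≤ h y := fun y hy => by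
    obtain ⟨z, hzS, hzy⟩ := exists_lt_of_csInf_lt hne hy
    have hz0 : x ≤ z := csInf_le hbdd hzS
    exact (show t ≤ h z from hzS).trans
      (hmono.monotoneOn (mem_Ici.2 (by linarith)) (mem_Ici.2 (by linarith)) hzy.le)
  rcases lt_trichotomy (h x) t with hlt | heq | hgt
  · obtain ⟨m, hm1, hm2⟩ := exists_between hlt
    have h1 := hhigh (x + 1) (by linarith)
    obtain ⟨z, hz, hzm⟩ := exists_hasDerivWithinAt_eq_of_gt_of_lt (a := x) (b := x + 1)
      (by linarith) (fun y _ => (hg y).hasDerivWithinAt) hm1 (by linarith)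
    linarith [hhigh z hz.1]
  · exact heq
  · obtain ⟨m, hm1, hm2⟩ := exists_between hgt
    have h1 := hlow 0 hpos
    obtain ⟨z, hz, hzm⟩ := exists_hasDerivWithinAt_eq_of_gt_of_lt (a := 0) (b := x)
      hpos.le (fun y _ => (hg y).hasDerivWithinAt) (m := m) (by linarith) hm2
    linarith [hlow z hz.2]

lemma MemRinfty.exists_regularInverse {g h : ℝ → ℝ} (hg : ∀ x, HasDerivAt g (h x) x)
    (H : MemRinfty h) : ∃ ψ e e', RegularInverse h ψ e e' := by
  obtain ⟨hmono, ε, ε', ε'', hd, -, hrep, hlim, h1, -, η, hη, c, hc, hlow⟩ := H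
  have hcont : Continuous ε := continuous_iff_continuousAt.2 fun x => (hd x).continuousAt
  have hεpos : ∀ᶠ x in atTop, 0 < ε x := by
    filter_upwards [hlow, eventually_gt_atTop 0] with x hx hx0
    exact pos_of_mul_pos_right (hc.trans_le hx) (Real.rpow_nonneg hx0.le η)
  have hbd : ∀ᶠ x in atTop, |x * ε' x| ≤ 1 * ε x := by
    filter_upwards [hεpos, Metric.tendsto_nhds.1 h1 1 one_pos] with x hx hx1
    rw [Real.dist_eq, sub_zero, abs_div, abs_of_pos hx, div_lt_one hx] at hx1
    linarith
  refine ⟨geninv h, ε, ε', hlim, ?_, ?_, ?_, Eventually.of_forall hd, hεpos, ⟨1, hbd⟩, ?_, ?_⟩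
  · filter_upwards [hlim.eventually_gt_atTop 0] with t ht
    exact apply_geninv hg hmono ht
  · filter_upwards [eventually_ge_atTop 0] with X hX
    exact hmono.monotoneOn.mono (Ici_subset_Ici.2 hX)
  · filter_upwards [eventually_gt_atTop 1] with t ht
    rw [hrep t ht.le, mul_div_assoc]
    refine (hasDerivAt_exp_integral_div hcont ht).congr_of_eventuallyEq ?_
    filter_upwards [Ioi_mem_nhds ht] with x hx
    exact hrep x (le_of_lt hx)
  · refine tendsto_atTop_mono' _ ?_ (hlim.const_mul_atTop hc)
    filter_upwards [hlow, eventually_ge_atTop 1, hεpos, hlim.eventually_gt_atTop 0]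
      with t ht1 ht2 ht3 ht4
    refine mul_le_mul_of_nonneg_right (ht1.trans ?_) ht4.le
    refine mul_le_mul_of_nonneg_right ?_ ht3.le
    exact (Real.rpow_le_rpow_of_exponent_le ht2 (by linarith [hη.2])).trans_eq (Real.rpow_one t)
  · obtain ⟨T, hT⟩ := eventually_atTop.1 (hbd.and (eventually_gt_atTop (0:ℝ)))
    have hder : ∀ x ∈ Ici T, HasDerivAt (fun x => ε x / x) ((ε' x * x - ε x * 1) / x ^ 2) x :=
      fun x hx => (hd x).div (hasDerivAt_id x) (hT x hx).2.ne'
    have hanti : AntitoneOn (fun x => ε x / x) (Ici T) := by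
      refine antitoneOn_of_deriv_nonpos (convex_Ici T)
        (fun x hx => (hder x hx).continuousAt.continuousWithinAt)
        (fun x hx => (hder x (interior_subset hx)).differentiableAt.differentiableWithinAt)
        fun x hx => ?_
      rw [(hder x (interior_subset hx)).deriv]
      have := (abs_le.1 (hT x (interior_subset hx)).1).2
      exact div_nonpos_of_nonpos_of_nonneg (by linarith) (sq_nonneg x)
    have hz : Tendsto (fun t => (ε T / T) * (geninv h t)⁻¹) atTop (𝓝 0) := by
      simpa using hlim.inv_tendsto_atTop.const_mul (ε T / T)
    refine squeeze_zero' ?_ ?_ hz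
    · filter_upwards [hεpos, hlim.eventually_gt_atTop 0, eventually_gt_atTop 0] with t ht1 ht2 ht3
      positivity
    · filter_upwards [hlim.eventually_gt_atTop 0, eventually_ge_atTop T] with t ht1 ht2
      rw [← div_div, div_eq_mul_inv]
      exact mul_le_mul_of_nonneg_right (hanti self_mem_Ici ht2 ht2) (inv_nonneg.2 ht1.le)

/-- A function with derivative bounded below by `k / x` grows without bound. -/
lemma tendsto_atTop_of_div_le_deriv {f f' : ℝ → ℝ} {X k : ℝ} (hX : 0 < X) (hk : 0 < k)
    (hf : ∀ x ≥ X, HasDerivAt f (f' x) x) (hf' : ∀ x ≥ X, k / x ≤ f' x) :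
    Tendsto f atTop atTop := by
  have hder : ∀ x ∈ Ici X, HasDerivAt (fun x => f x - k * Real.log x) (f' x - k * x⁻¹) x :=
    fun x hx => (hf x hx).sub ((Real.hasDerivAt_log (hX.trans_le hx).ne').const_mul k)
  have hmono : MonotoneOn (fun x => f x - k * Real.log x) (Ici X) := by
    refine monotoneOn_of_deriv_nonneg (convex_Ici X)
      (fun x hx => (hder x hx).continuousAt.continuousWithinAt)
      (fun x hx => (hder x (interior_subset hx)).differentiableAt.differentiableWithinAt)
      fun x hx => ?_
    rw [(hder x (interior_subset hx)).deriv, ← div_eq_mul_inv]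
    exact sub_nonneg.2 (hf' x (interior_subset hx))
  refine tendsto_atTop_mono' _ ?_ (tendsto_atTop_add_const_left _ (f X - k * Real.log X)
    (Real.tendsto_log_atTop.const_mul_atTop hk))
  filter_upwards [eventually_ge_atTop X] with x hx
  have := hmono self_mem_Ici hx hx
  simp only at this
  linarith

lemma MemRbeta.exists_regularInverse {h : ℝ → ℝ} {β : ℝ} (H : MemRbeta h β) :
    ∃ ψ e e', RegularInverse h ψ e e' := by
  obtain ⟨hβ, l, ε, ε', ε'', ⟨hd, -, hlim, hl⟩, hh, ⟨C, hC⟩, -⟩ := H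
  have hcont : Continuous ε := continuous_iff_continuousAt.2 fun x => (hd x).continuousAt
  obtain ⟨X₀, hX₀⟩ := eventually_atTop.1 hh
  have hder₀ : ∀ x > max X₀ 1, 0 < h x ∧ HasDerivAt h (h x * (β + ε x) / x) x := by
    intro x hx
    have hx1 : 1 < x := (le_max_right _ _).trans_lt hx
    have hx0 : 0 < x := by linarith
    have heq : ∀ y > max X₀ 1, h y = y ^ β * Real.exp (∫ u in (1:ℝ)..y, ε u / u) := fun y hy => by
      rw [hX₀ y ((le_max_left _ _).trans hy.le), hl y ((le_max_right _ _).trans hy.le)]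
    refine ⟨by rw [heq x hx]; positivity, ?_⟩
    have hprod := (Real.hasDerivAt_rpow_const (p := β) (Or.inl hx0.ne')).mul
      (hasDerivAt_exp_integral_div hcont hx1)
    refine (hprod.congr_of_eventuallyEq ?_).congr_deriv ?_
    · filter_upwards [Ioi_mem_nhds hx] with y hy
      exact heq y hy
    · rw [heq x hx, Real.rpow_sub_one hx0.ne']
      field_simp
  obtain ⟨X, hX⟩ := eventually_atTop.1 ((eventually_gt_atTop (max X₀ 1)).and
    ((hlim.eventually_const_lt (show -(β / 2) < 0 by linarith)).and
      ((hlim.eventually_lt_const hβ).and hC)))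
  have hX1 : ∀ x ≥ X, 1 < x := fun x hx => (le_max_right _ _).trans_lt (hX x hx).1
  have hpos : ∀ x ≥ X, 0 < h x := fun x hx => (hder₀ x (hX x hx).1).1
  have hder : ∀ x ≥ X, HasDerivAt h (h x * (β + ε x) / x) x :=
    fun x hx => (hder₀ x (hX x hx).1).2
  have hlow : ∀ x ≥ X, β / 2 < β + ε x := fun x hx => by linarith [(hX x hx).2.1]
  have hup : ∀ x ≥ X, β + ε x < 2 * β := fun x hx => by linarith [(hX x hx).2.2.1]
  have hC0 : 0 ≤ C := le_trans (mul_nonneg (by linarith [hX1 X le_rfl]) (abs_nonneg _))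
    (hX X le_rfl).2.2.2
  have hcontOn : ContinuousOn h (Ici X) := fun x hx =>
    (hder x hx).continuousAt.continuousWithinAt
  have hmono : StrictMonoOn h (Ici X) := by
    refine strictMonoOn_of_deriv_pos (convex_Ici X) hcontOn fun x hx => ?_
    have hx' : x ≥ X := interior_subset hx
    rw [(hder x hx').deriv]
    exact div_pos (mul_pos (hpos x hx') (by linarith [hlow x hx'])) (by linarith [hX1 x hx'])
  have htop : Tendsto h atTop atTop := by
    refine tendsto_atTop_of_div_le_deriv (k := h X * (β / 2)) (by linarith [hX1 X le_rfl])
      (mul_pos (hpos X le_rfl) (by linarith)) hder fun x hx => ?_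
    have := hX1 x hx
    refine div_le_div_of_nonneg_right ?_ (by linarith)
    exact mul_le_mul (hmono.monotoneOn self_mem_Ici hx hx) (hlow x hx).le (by linarith)
      (hpos x hx).le
  have hex : ∀ t, ∃ x, h X ≤ t → X ≤ x ∧ h x = t := by
    intro t
    by_cases ht : h X ≤ t
    · obtain ⟨Y, hY1, hY2⟩ := ((htop.eventually_ge_atTop t).and (eventually_ge_atTop X)).exists
      obtain ⟨x, hx, hxt⟩ := intermediate_value_Icc hY2 (hcontOn.mono Icc_subset_Ici_self)
        ⟨ht, hY1⟩
      exact ⟨x, fun _ => ⟨hx.1, hxt⟩⟩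
    · exact ⟨0, fun h => absurd h ht⟩
  choose ψ hψ using hex
  have hψlim : Tendsto ψ atTop atTop := by
    rw [Filter.tendsto_atTop]
    intro b
    filter_upwards [eventually_ge_atTop (h (max b X)), eventually_ge_atTop (h X)] with t ht1 ht2
    obtain ⟨h1, h2⟩ := hψ t ht2
    by_contra! hn
    have := hmono h1 (le_max_right b X) (hn.trans_le (le_max_left b X))
    linarith
  have hψmono : StrictMonoOn ψ (Ici (h X)) := by
    intro a ha b hb hab
    by_contra! hn
    have := hmono.monotoneOn (hψ b hb).1 (hψ a ha).1 hn
    rw [(hψ a ha).2, (hψ b hb).2] at this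
    linarith
  have hψcont : ∀ t > h X, ContinuousAt ψ t := by
    intro t ht
    refine hψmono.continuousAt_of_image_mem_nhds (Ici_mem_nhds ht) ?_
    have hlt : X < ψ t := by
      rcases (hψ t ht.le).1.lt_or_eq with h1 | h1
      · exact h1
      · have := (hψ t ht.le).2
        rw [← h1] at this
        linarith
    filter_upwards [Ici_mem_nhds hlt] with x hx
    have h1 := hmono.monotoneOn self_mem_Ici hx hx
    exact ⟨h x, h1, hmono.injOn (hψ _ h1).1 hx (hψ _ h1).2⟩
  have hψder : ∀ t > h X, HasDerivAt ψ (ψ t * (β + ε (ψ t))⁻¹ / t) t := by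
    intro t ht
    obtain ⟨h1, h2⟩ := hψ t ht.le
    have ht0 : 0 < t := (hpos X le_rfl).trans ht
    have h3 := hX1 _ h1
    have h4 : 0 < β + ε (ψ t) := by linarith [hlow _ h1]
    have hd1 := hder _ h1
    rw [h2] at hd1
    refine (HasDerivAt.of_local_left_inverse (hψcont t ht) hd1 (by positivity) ?_).congr_deriv ?_
    · filter_upwards [Ioi_mem_nhds ht] with y hy
      exact (hψ y (le_of_lt hy)).2
    · field_simp
  refine ⟨ψ, fun t => (β + ε (ψ t))⁻¹,
    fun t => -(ε' (ψ t) * (ψ t * (β + ε (ψ t))⁻¹ / t)) / (β + ε (ψ t)) ^ 2,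
    hψlim, ?_, ?_, ?_, ?_, ?_, ⟨4 * C / β ^ 2, ?_⟩, ?_, ?_⟩
  · filter_upwards [eventually_ge_atTop (h X)] with t ht
    exact (hψ t ht).2
  · filter_upwards [eventually_ge_atTop X] with Y hY
    exact hmono.monotoneOn.mono (Ici_subset_Ici.2 hY)
  · filter_upwards [eventually_gt_atTop (h X)] with t ht
    exact hψder t ht
  · filter_upwards [eventually_gt_atTop (h X)] with t ht
    have h4 := hlow _ (hψ t ht.le).1
    exact (((hd (ψ t)).comp t (hψder t ht)).const_add β).inv (by simp only [Function.comp]; linarith)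
  · filter_upwards [eventually_ge_atTop (h X)] with t ht
    have h4 := hlow _ (hψ t ht).1
    exact inv_pos.2 (by linarith)
  · filter_upwards [eventually_ge_atTop (h X), eventually_gt_atTop 0] with t ht ht0
    obtain ⟨h1, h2⟩ := hψ t ht
    have h3 := hX1 _ h1
    have h4 := hlow _ h1
    have h5 := (hX _ h1).2.2.2
    have h6 : 0 < β + ε (ψ t) := by linarith
    have e1 : t * (-(ε' (ψ t) * (ψ t * (β + ε (ψ t))⁻¹ / t)) / (β + ε (ψ t)) ^ 2) =
        -(ψ t * ε' (ψ t)) * ((β + ε (ψ t))⁻¹ * ((β + ε (ψ t)) ^ 2)⁻¹) := by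
      field_simp
    have h7 : ((β + ε (ψ t)) ^ 2)⁻¹ ≤ 4 / β ^ 2 := by
      rw [inv_eq_one_div, div_le_div_iff₀ (by positivity) (by positivity)]
      nlinarith
    rw [e1, abs_mul, abs_neg, abs_mul, abs_of_pos (show 0 < ψ t by linarith),
      abs_of_pos (by positivity : 0 < (β + ε (ψ t))⁻¹ * ((β + ε (ψ t)) ^ 2)⁻¹)]
    calc ψ t * |ε' (ψ t)| * ((β + ε (ψ t))⁻¹ * ((β + ε (ψ t)) ^ 2)⁻¹)
        ≤ C * ((β + ε (ψ t))⁻¹ * (4 / β ^ 2)) := by gcongr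
      _ = _ := by ring
  · refine tendsto_atTop_mono' _ ?_ (tendsto_id.const_mul_atTop
      (show 0 < (2 * β)⁻¹ by positivity))
    filter_upwards [eventually_ge_atTop (h X), eventually_gt_atTop 0] with t ht ht0
    obtain ⟨h1, h2⟩ := hψ t ht
    have h3 := hX1 _ h1
    have h4 := hlow _ h1
    have h6 : 0 < β + ε (ψ t) := by linarith
    have h7 : (2 * β)⁻¹ ≤ (β + ε (ψ t))⁻¹ := inv_anti₀ h6 (hup _ h1).le
    calc (2 * β)⁻¹ * t = t * (2 * β)⁻¹ * 1 := by ring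
      _ ≤ t * (β + ε (ψ t))⁻¹ * ψ t := by gcongr
  · have hz : Tendsto (fun t : ℝ => (β / 2)⁻¹ * t⁻¹) atTop (𝓝 0) := by
      simpa using tendsto_inv_atTop_zero.const_mul (β / 2)⁻¹
    refine squeeze_zero' ?_ ?_ hz
    all_goals
      filter_upwards [eventually_ge_atTop (h X), eventually_gt_atTop 0] with t ht ht0
      obtain ⟨h1, h2⟩ := hψ t ht
      have h3 := hX1 _ h1
      have h4 := hlow _ h1
      have h6 : 0 < β + ε (ψ t) := by linarith
    · positivity
    · rw [div_eq_mul_inv]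
      have h7 : (β + ε (ψ t))⁻¹ ≤ (β / 2)⁻¹ := inv_anti₀ (by positivity) h4.le
      have h8 : (t * ψ t)⁻¹ ≤ t⁻¹ := inv_anti₀ ht0 (by nlinarith)
      gcongr

lemma MemFrakR.exists_selfNeglectingInverse {g h : ℝ → ℝ} (hg : ∀ x, HasDerivAt g (h x) x)
    (H : MemFrakR h) : ∃ ψ D, SelfNeglectingInverse h ψ D := by
  obtain ⟨ψ, e, e', hreg⟩ : ∃ ψ e e', RegularInverse h ψ e e' := by
    rcases H with ⟨β, hβ⟩ | hinf
    · exact hβ.exists_regularInverse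
    · exact hinf.exists_regularInverse hg
  exact ⟨_, _, hreg.selfNeglectingInverse⟩

/-- For any compact `K ⊆ ℝ`,
`lim_{t→∞} sup_{u ∈ K} s²(t + u/s(t))/s²(t) = 1`. -/
theorem variance_ratio_uniform_on_compacts
    (p g q h : ℝ → ℝ) (c : ℝ) (hc : 0 < c)
    (hpdef : ∀ x ≥ (0:ℝ), p x = c * Real.exp (-(g x - q x)))
    (hpzero : ∀ x < (0:ℝ), p x = 0)
    (hpdens : (∫ x in Set.Ici (0:ℝ), p x) = 1)
    (hgpos : ∀ x ≥ (0:ℝ), 0 < g x)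
    (hglim : Tendsto (fun x => g x / x) atTop atTop)
    (hgderiv : ∀ x, HasDerivAt g (h x) x)
    (hq : ∃ ϑ > (0:ℝ), ∀ᶠ x in atTop, ∀ v, |v - x| < ϑ * x → |q v| ≤ 1 / Real.sqrt (x * h x))
    (hmem : MemFrakR h)
    (hPhi : ∀ t > (0:ℝ), IntegrableOn (fun x => Real.exp (t * x) * p x) (Set.Ici 0))
    :
    ∀ K : Set ℝ, IsCompact K → ∀ ε > (0:ℝ), ∀ᶠ t in atTop, ∀ u ∈ K,
      |s2Fun p (t + u / Real.sqrt (s2Fun p t)) / s2Fun p t - 1| < ε := by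
  obtain ⟨ψ, D, H⟩ := hmem.exists_selfNeglectingInverse hgderiv
  have hint : IntegrableOn p (Ici 0) := by
    by_contra hn
    rw [integral_undef hn] at hpdens
    exact zero_ne_one hpdens
  have hq0 : Tendsto q atTop (𝓝 0) := by
    obtain ⟨ϑ, hϑ, hqb⟩ := hq
    have hz : Tendsto (fun x => 1 / √(x * h x)) atTop (𝓝 0) := by
      simp only [one_div]
      exact (Real.tendsto_sqrt_atTop.comp
        (tendsto_id.atTop_mul_atTop₀ H.tendsto_h)).inv_tendsto_atTop
    refine squeeze_zero_norm' ?_ hz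
    filter_upwards [hqb, eventually_gt_atTop 0] with x hx hx0
    exact hx x (by rw [sub_self, abs_zero]; positivity)
  intro K hK ε hε
  obtain ⟨A, hA⟩ := hK.isBounded.exists_norm_le
  filter_upwards [H.ratio_uniform (H.tendsto_s2Fun_div hc hgderiv hpdef hint hPhi hq0) A hε]
    with t ht u hu
  exact ht u (hA u hu)
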